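/- Let R1 and R2 be relations over attribute sets U1 and U2 such that π_{U1}(R1 ⋈ R2) ⊆ R1, let F be a filter over U1 ∪ U2, and set S = R1 ⋈ R2. Then π_{U1}(S ∖ σ_F S) ≡ π_{U1}S ∖ π_{U1}σ_F S. -/

import Mathlib

noncomputable section
open Classical

attribute [local instance 10] Classical.propDecidable

namespace RA

variable {A Δ : Type} [DecidableEq A] [DecidableEq Δ]

/-- Three-valued logic: true, false, unknown (error). -/
inductive TV where
  | tt | ff | unk
deriving DecidableEq

/-- Kleene conjunction. -/
def TV.and : TV → TV → TV
  | .ff, _ => .ff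
  | _, .ff => .ff
  | .tt, .tt => .tt
  | _, _ => .unk

/-- Kleene negation. -/
def TV.not : TV → TV
  | .tt => .ff
  | .ff => .tt
  | .unk => .unk

mutual
/-- Terms over attributes `A` and domain `Δ`: attributes, constants and conditionals. -/
inductive Term (A Δ : Type) where
  | attr : A → Term A Δ
  | const : Δ → Term A Δ
  | ite : Filter A Δ → Term A Δ → Term A Δ → Term A Δ

/-- RA filters: `isNull` on a (finite) set of terms, equality, conjunction, negation. -/
inductive Filter (A Δ : Type) where
  | isNull : List (Term A Δ) → Filter A Δ
  | eq : Term A Δ → Term A Δ → Filter A Δ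
  | and : Filter A Δ → Filter A Δ → Filter A Δ
  | not : Filter A Δ → Filter A Δ
end

/-- Disjunction: `F1 ∨ F2 = ¬(¬F1 ∧ ¬F2)`. -/
def Filter.or (F1 F2 : Filter A Δ) : Filter A Δ := .not ((Filter.not F1).and (Filter.not F2))

/-- The tautological filter ⊤ (`isNull` of the empty set of terms is always true). -/
def Filter.tru : Filter A Δ := .isNull []

/-- A tuple over a set of attributes: `none` marks attributes outside the set. -/
abbrev Tuple (A Δ : Type) := A → Option Δ

mutual
/-- Evaluation of a term on a tuple (`null` is the distinguished null value of `Δ`). -/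
def Term.eval (null : Δ) (t : Tuple A Δ) : Term A Δ → Δ
  | .attr a => (t a).getD null
  | .const c => c
  | .ite F v v' => if F.eval null t = TV.tt then v.eval null t else v'.eval null t

def Term.evalList (null : Δ) (t : Tuple A Δ) : List (Term A Δ) → List Δ
  | [] => []
  | v :: vs => v.eval null t :: Term.evalList null t vs

/-- Three-valued evaluation of a filter on a tuple. -/
def Filter.eval (null : Δ) (t : Tuple A Δ) : Filter A Δ → TV
  | .isNull V => if ∀ d ∈ Term.evalList null t V, d = null then .tt else .ff
  | .eq v v' =>
      if v.eval null t = null ∨ v'.eval null t = null then .unk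
      else if v.eval null t = v'.eval null t then .tt else .ff
  | .and F1 F2 => (F1.eval null t).and (F2.eval null t)
  | .not F => (F.eval null t).not
end

mutual
/-- Attributes occurring in a term. -/
def Term.attrs : Term A Δ → Finset A
  | .attr a => {a}
  | .const _ => ∅
  | .ite F v v' => F.attrs ∪ v.attrs ∪ v'.attrs

def Term.attrsList : List (Term A Δ) → Finset A
  | [] => ∅
  | v :: vs => v.attrs ∪ Term.attrsList vs

/-- Attributes occurring in a filter. -/
def Filter.attrs : Filter A Δ → Finset A
  | .isNull V => Term.attrsList V
  | .eq v v' => v.attrs ∪ v'.attrs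
  | .and F1 F2 => F1.attrs ∪ F2.attrs
  | .not F => F.attrs
end

/-- A term is over `U` if all its attributes are in `U`. -/
def Term.over (v : Term A Δ) (U : Finset A) : Prop := v.attrs ⊆ U

/-- A filter is over `U` if all its attributes are in `U`. -/
def Filter.over (F : Filter A Δ) (U : Finset A) : Prop := F.attrs ⊆ U

/-- A tuple is over `U` if its domain is exactly `U`. -/
def Tuple.isOver (t : Tuple A Δ) (U : Finset A) : Prop := ∀ a, (t a).isSome ↔ a ∈ U

/-- A relation is a bag (multiset) of tuples. -/
abbrev Rel (A Δ : Type) := Multiset (Tuple A Δ)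

/-- A relation is over `U` if all its tuples are. -/
def Rel.isOver (R : Rel A Δ) (U : Finset A) : Prop := ∀ t ∈ R, t.isOver U

/-- Selection σ_F. -/
def select (null : Δ) (F : Filter A Δ) (R : Rel A Δ) : Rel A Δ :=
  R.filter (fun t => F.eval null t = .tt)

/-- Restriction of a tuple to the attributes in `U`. -/
def Tuple.restrict (t : Tuple A Δ) (U : Finset A) : Tuple A Δ :=
  fun a => if a ∈ U then t a else none

/-- Projection π_U (bag semantics: multiplicities are added up). -/
def proj (U : Finset A) (R : Rel A Δ) : Rel A Δ := R.map (·.restrict U)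

/-- Bag difference: `(R1 ∖ R2)(t) = R1(t)` if `t ∉ R2` and `0` otherwise. -/
def bdiff (R1 R2 : Rel A Δ) : Rel A Δ := R1.filter (fun t => t ∉ R2)

/-- Compatibility of tuples: equal and non-null on the shared attributes. -/
def Compat (null : Δ) (t1 t2 : Tuple A Δ) : Prop :=
  ∀ a, (t1 a).isSome → (t2 a).isSome → (t1 a = t2 a ∧ t1 a ≠ some null)

/-- `t1 ⊕ t2`: the common extension of two (compatible) tuples. -/
def Tuple.merge (t1 t2 : Tuple A Δ) : Tuple A Δ :=
  fun a => (t1 a).or (t2 a)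

/-- Natural join. -/
def join (null : Δ) (R1 R2 : Rel A Δ) : Rel A Δ :=
  (R1.product R2).filterMap
    (fun p => if Compat null p.1 p.2 then some (p.1.merge p.2) else none)

/-- Natural join with a filter: `R1 ⋈_F R2 = σ_F (R1 ⋈ R2)`. -/
def joinF (null : Δ) (F : Filter A Δ) (R1 R2 : Rel A Δ) : Rel A Δ :=
  select null F (join null R1 R2)

/-- Padding of a tuple with `null` on the attributes of `V`. -/
def Tuple.pad (null : Δ) (V : Finset A) (t : Tuple A Δ) : Tuple A Δ :=
  fun a => if a ∈ V then (t a).or (some null) else t a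

/-- Outer union of `R1` over `U1` and `R2` over `U2`:
each relation is padded with nulls on the attributes missing from it. -/
def ounion (null : Δ) (U1 U2 : Finset A) (R1 R2 : Rel A Δ) : Rel A Δ :=
  R1.map (Tuple.pad null (U2 \ U1)) + R2.map (Tuple.pad null (U1 \ U2))

/-- Left join `R1 ⟕_F R2 = (R1 ⋈_F R2) ⊎ (R1 ∖ π_{U1}(R1 ⋈_F R2))`
for `R1` over `U1` and `R2` over `U2`. -/
def ljoin (null : Δ) (U1 U2 : Finset A) (F : Filter A Δ) (R1 R2 : Rel A Δ) : Rel A Δ :=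
  ounion null (U1 ∪ U2) U1 (joinF null F R1 R2) (bdiff R1 (proj U1 (joinF null F R1 R2)))

/-- Natural left join `R1 ⟕ R2 = R1 ⟕_⊤ R2`. -/
def nljoin (null : Δ) (U1 U2 : Finset A) (R1 R2 : Rel A Δ) : Rel A Δ :=
  ljoin null U1 U2 Filter.tru R1 R2

/-- Extension ν_{u↦v}. -/
def extend (null : Δ) (u : A) (v : Term A Δ) (R : Rel A Δ) : Rel A Δ :=
  R.map (fun t a => if a = u then some (v.eval null t) else t a)

/-- Duplicate elimination δ. -/
def dedup (R : Rel A Δ) : Rel A Δ := R.dedup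

/-- Extended renaming ρ^V_{{u/f(u) | u ∈ S}} at the level of tuples:
each attribute `u ∈ S` receives the value of the term `f u` (evaluated on the original
tuple) and the attributes of `V ∖ S` are projected away. -/
def renameFun (null : Δ) (V S : Finset A) (f : A → Term A Δ) (t : Tuple A Δ) : Tuple A Δ :=
  fun a => if a ∈ S then some ((f a).eval null t) else if a ∈ V then none else t a

/-- Extended renaming ρ^V_{{u/f(u) | u ∈ S}}. -/
def rename (null : Δ) (V S : Finset A) (f : A → Term A Δ) (R : Rel A Δ) : Rel A Δ :=
  R.map (renameFun null V S f)

/-- Renaming of the attribute `uold` into `unew` at the level of tuples. -/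
def renameAttrT (unew uold : A) (t : Tuple A Δ) : Tuple A Δ :=
  fun a => if a = unew then t uold else if a = uold then none else t a

/-- `R[unew/uold]`: the relation `R` with the attribute `uold` renamed to `unew`. -/
def renameAttr (unew uold : A) (R : Rel A Δ) : Rel A Δ := R.map (renameAttrT unew uold)

/-- `coalesce(v, v') = if(¬isNull(v), v, v')`. -/
def Term.coalesce (v v' : Term A Δ) : Term A Δ := .ite (.not (.isNull [v])) v v'

/-- The filter `⋀_{u ∈ K} ¬isNull(u)`. -/
def notNullAll (K : Finset A) : Filter A Δ :=
  K.toList.foldr (fun u acc => (Filter.not (.isNull [.attr u])).and acc) Filter.tru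

mutual
/-- `nullify_S`: replace every occurrence of an attribute from `S` by the constant null. -/
def Term.nullify (null : Δ) (S : Finset A) : Term A Δ → Term A Δ
  | .attr a => if a ∈ S then .const null else .attr a
  | .const c => .const c
  | .ite F v v' => .ite (F.nullify null S) (v.nullify null S) (v'.nullify null S)

def Term.nullifyList (null : Δ) (S : Finset A) : List (Term A Δ) → List (Term A Δ)
  | [] => []
  | v :: vs => v.nullify null S :: Term.nullifyList null S vs

/-- `nullify_S` on filters. -/
def Filter.nullify (null : Δ) (S : Finset A) : Filter A Δ → Filter A Δ
  | .isNull V => .isNull (Term.nullifyList null S V)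
  | .eq v v' => .eq (v.nullify null S) (v'.nullify null S)
  | .and F1 F2 => .and (F1.nullify null S) (F2.nullify null S)
  | .not F => .not (F.nullify null S)
end

/-- p-equivalence of filters over `U`: they are ⊤ on the same tuples over `U`. -/
def pequiv (null : Δ) (U : Finset A) (F1 F2 : Filter A Δ) : Prop :=
  ∀ t : Tuple A Δ, t.isOver U → (F1.eval null t = TV.tt ↔ F2.eval null t = TV.tt)

end RA

namespace RA

variable {A Δ : Type} [DecidableEq A] [DecidableEq Δ]

theorem join_add (null : Δ) (R R' S : Rel A Δ) :
    join null (R + R') S = join null R S + join null R' S := by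
  unfold join
  rw [← Multiset.filterMap_add]
  exact congrArg _ (Multiset.add_product R R' S)

theorem join_cons (null : Δ) (R S : Rel A Δ) (t : Tuple A Δ) :
    join null R (t ::ₘ S) = join null R {t} + join null R S := by
  unfold join
  rw [← Multiset.filterMap_add]
  exact congrArg _ (Multiset.product_add R {t} S)

theorem proj_add (U : Finset A) (R S : Rel A Δ) : proj U (R + S) = proj U R + proj U S :=
  Multiset.map_add _ _ _

theorem mem_join {null : Δ} {R S : Rel A Δ} {s : Tuple A Δ} :
    s ∈ join null R S ↔ ∃ t₁ ∈ R, ∃ t₂ ∈ S, Compat null t₁ t₂ ∧ t₁.merge t₂ = s := by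
  unfold join
  rw [Multiset.mem_filterMap]
  constructor
  · rintro ⟨⟨t₁, t₂⟩, hp, hs⟩
    obtain ⟨h₁, h₂⟩ := Multiset.mem_product.1 hp
    split_ifs at hs with hc
    exact ⟨t₁, h₁, t₂, h₂, hc, Option.some.inj hs⟩
  · rintro ⟨t₁, h₁, t₂, h₂, hc, rfl⟩
    exact ⟨(t₁, t₂), Multiset.mem_product.2 ⟨h₁, h₂⟩, if_pos hc⟩

theorem Tuple.restrict_merge {t₁ t₂ : Tuple A Δ} {U : Finset A}
    (h : t₁.isOver U) : (t₁.merge t₂).restrict U = t₁ := by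
  funext a
  have ha := h a
  cases ht : t₁ a <;> simp_all [Tuple.restrict, Tuple.merge]

theorem count_le_count_proj_join_singleton {null : Δ} {t₁ t₂ : Tuple A Δ} {U : Finset A}
    (h : t₁.isOver U) (hc : Compat null t₁ t₂) (R : Rel A Δ) :
    R.count t₁ ≤ (proj U (join null R {t₂})).count t₁ := by
  induction R using Multiset.induction_on with
  | empty => simp
  | cons a R ih =>
    rw [← Multiset.singleton_add, join_add, proj_add, Multiset.count_add, Multiset.count_add]
    refine Nat.add_le_add ?_ ih
    by_cases ha : t₁ = a
    · subst ha
      rw [Multiset.count_singleton_self, Multiset.one_le_count_iff_mem]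
      exact Multiset.mem_map.2 ⟨_, mem_join.2 ⟨t₁, by simp, t₂, by simp, hc, rfl⟩,
        Tuple.restrict_merge h⟩
    · simp [ha]

theorem restrict_injOn_join {null : Δ} {U : Finset A} {R S : Rel A Δ} (hR : R.isOver U)
    (hsub : proj U (join null R S) ≤ R) :
    Set.InjOn (fun s : Tuple A Δ => s.restrict U) {s | s ∈ join null R S} := by
  intro s hs s' hs' heq
  obtain ⟨t, ht, u, hu, hc, rfl⟩ := mem_join.1 hs
  obtain ⟨t', ht', u', hu', hc', rfl⟩ := mem_join.1 hs'
  have htt : t = t' := by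
    simpa only [Tuple.restrict_merge (hR t ht),
      Tuple.restrict_merge (hR t' ht')] using heq
  subst htt
  by_contra hne
  have huu : u' ≠ u := by
    rintro rfl
    exact hne rfl
  obtain ⟨S₁, rfl⟩ := Multiset.exists_cons_of_mem hu
  obtain ⟨S₂, rfl⟩ := Multiset.exists_cons_of_mem ((Multiset.mem_cons.1 hu').resolve_left huu)
  have hle := Multiset.count_le_of_le t hsub
  rw [join_cons, join_cons, proj_add, proj_add, Multiset.count_add, Multiset.count_add] at hle
  have h₁ := count_le_count_proj_join_singleton (hR t ht) hc R
  have h₂ := count_le_count_proj_join_singleton (hR t ht) hc' R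
  have hpos := Multiset.count_pos.2 ht
  omega

theorem proj_bdiff_of_injOn {U : Finset A} {R S : Rel A Δ} (hSR : S ≤ R)
    (hinj : Set.InjOn (fun s : Tuple A Δ => s.restrict U) {s | s ∈ R}) :
    proj U (bdiff R S) = bdiff (proj U R) (proj U S) := by
  unfold proj bdiff
  rw [Multiset.filter_map]
  refine congrArg _ (Multiset.filter_congr fun s hs => not_congr ?_)
  refine ⟨fun h => Multiset.mem_map_of_mem _ h, fun h => ?_⟩
  obtain ⟨s', hs', heq⟩ := Multiset.mem_map.1 h
  exact hinj (Multiset.mem_of_le hSR hs') hs heq ▸ hs'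

theorem stmt10 (null : Δ) (U1 U2 : Finset A) (R1 R2 : Rel A Δ) (F : Filter A Δ)
    (hR1 : R1.isOver U1) (hR2 : R2.isOver U2) (hF : F.over (U1 ∪ U2))
    (hsub : proj U1 (join null R1 R2) ≤ R1) :
    proj U1 (bdiff (join null R1 R2) (select null F (join null R1 R2)))
      = bdiff (proj U1 (join null R1 R2)) (proj U1 (select null F (join null R1 R2))) :=
  proj_bdiff_of_injOn (Multiset.filter_le _ _) (restrict_injOn_join hR1 hsub)

end RA
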